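/- Let W be a finite set of Wang tiles, let K be a set with · : K×K → 𝒫(K) satisfying (h) x·y ⊆ x·(x·y), (p) (x·y)·z ⊆ x·(y·z) and (s) (x·y)·z ⊆ y·(x·z) for all x,y,z ∈ K, and let V be any valuation assigning subsets of K to propositional letters. If there is a point g ∈ K such that g ⊩ α ∧ β₁ ∧ β₂ ∧ γ ∧ G_{0,0} and g ⊮ x' → m^c_{1,0}, then W tiles the k-octant 𝕆(k) for every k ∈ ℕ. -/

import Mathlib

/-- Formulas of the language 𝓛: propositional letters (indexed by ℕ) with ∧, ∨, →. -/
inductive Fml : Type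
  | atom : ℕ → Fml
  | and : Fml → Fml → Fml
  | or : Fml → Fml → Fml
  | imp : Fml → Fml → Fml
deriving DecidableEq

/-- Satisfaction at a point of a structure `(K, ·)` with valuation `V`. -/
def Sat {K : Type*} (op : K → K → Set K) (V : ℕ → Set K) : K → Fml → Prop
  | x, .atom p => x ∈ V p
  | x, .and φ ψ => Sat op V x φ ∧ Sat op V x ψ
  | x, .or φ ψ => Sat op V x φ ∨ Sat op V x ψ
  | x, .imp φ ψ => ∀ y z, Sat op V y φ → z ∈ op x y → Sat op V z ψ

/-- `x·Y = ⋃ y ∈ Y, x·y`. -/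
def setL {K : Type*} (op : K → K → Set K) (x : K) (Y : Set K) : Set K :=
  ⋃ y ∈ Y, op x y

/-- `X·y = ⋃ x ∈ X, x·y`. -/
def setR {K : Type*} (op : K → K → Set K) (X : Set K) (y : K) : Set K :=
  ⋃ x ∈ X, op x y

/-- A Wang tile: a quadruple `(t_W, t_E, t_N, t_S)` of natural numbers. -/
abbrev Tile : Type := ℕ × ℕ × ℕ × ℕ

/-- West colour. -/
def tW (t : Tile) : ℕ := t.1
/-- East colour. -/
def tE (t : Tile) : ℕ := t.2.1
/-- North colour. -/
def tN (t : Tile) : ℕ := t.2.2.1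
/-- South colour. -/
def tS (t : Tile) : ℕ := t.2.2.2

/-- `W` tiles `D ⊆ ℤ²`: there is a map assigning to each point of `D` a tile of `W`
such that horizontally and vertically adjacent tiles within `D` match. -/
def Tiles (W : Finset Tile) (D : Set (ℤ × ℤ)) : Prop :=
  ∃ τ : ℤ × ℤ → Tile,
    (∀ p ∈ D, τ p ∈ W) ∧
    (∀ m n : ℤ, (m, n) ∈ D → (m + 1, n) ∈ D → tE (τ (m, n)) = tW (τ (m + 1, n))) ∧
    (∀ m n : ℤ, (m, n) ∈ D → (m, n + 1) ∈ D → tN (τ (m, n)) = tS (τ (m, n + 1)))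

/-- The `k`-quadrant `ℚ(k) = {(m,n) : 0 ≤ m,n ≤ k}`. -/
def Quadrant (k : ℕ) : Set (ℤ × ℤ) :=
  {p | 0 ≤ p.1 ∧ p.1 ≤ (k : ℤ) ∧ 0 ≤ p.2 ∧ p.2 ≤ (k : ℤ)}

/-- The `k`-octant `𝕆(k) = {(m,n) : 0 ≤ m ≤ n ≤ k}`. -/
def Octant (k : ℕ) : Set (ℤ × ℤ) :=
  {p | 0 ≤ p.1 ∧ p.1 ≤ p.2 ∧ p.2 ≤ (k : ℤ)}

/-- The propositional letters used in the tiling formulas: one letter `𝚝` for each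
tile `t`, letters `𝚖_{i,j}` for `i,j ∈ {0,1}` (here indexed by `Bool`, `false = 0`,
`true = 1`), and letters `𝚡`, `𝚢`, `𝚙⊤`. -/
inductive Letter : Type
  | tile : Tile → Letter
  | m : Bool → Bool → Letter
  | x : Letter
  | y : Letter
  | pTop : Letter
deriving DecidableEq

/-- Disjunction of a list of formulas (a given default for the empty list). -/
def bigOr (dflt : Fml) : List Fml → Fml
  | [] => dflt
  | f :: fs => fs.foldl .or f

/-- Conjunction of a list of formulas (a given default for the empty list). -/
def bigAnd (dflt : Fml) : List Fml → Fml
  | [] => dflt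
  | f :: fs => fs.foldl .and f

/-- Product of two lists. -/
def listProd {α β : Type*} (l₁ : List α) (l₂ : List β) : List (α × β) :=
  l₁.foldr (fun a acc => (l₂.map fun b => (a, b)) ++ acc) []

/-- The four pairs `(i,j)` with `i,j ∈ {0,1}`. -/
def boolPairs : List (Bool × Bool) :=
  [(false, false), (false, true), (true, false), (true, true)]

variable (enc : Letter → ℕ)

/-- The atom `𝚝` for a tile `t`. -/
def tAt (t : Tile) : Fml := .atom (enc (.tile t))
/-- The atom `𝚖_{i,j}`. -/
def mAt (i j : Bool) : Fml := .atom (enc (.m i j))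
/-- The atom `𝚡`. -/
def xAt : Fml := .atom (enc .x)
/-- The atom `𝚢`. -/
def yAt : Fml := .atom (enc .y)
/-- The atom `𝚙⊤`. -/
def pAt : Fml := .atom (enc .pTop)

/-- The surrogate used for an empty disjunction: `𝚖_{0,0} ∧ 𝚖_{0,1}`. -/
def emptyOr : Fml := .and (mAt enc false false) (mAt enc false true)

/-- The surrogate used for an empty conjunction: `𝚙⊤ → 𝚙⊤`. -/
def emptyAnd : Fml := .imp (pAt enc) (pAt enc)

/-- `R(t) = ⋁{𝚝' : t' ∈ W, t_E = t'_W}`: the permissible rightwards neighbours. -/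
noncomputable def Rt (W : Finset Tile) (t : Tile) : Fml :=
  bigOr (emptyOr enc) (((W.filter fun t' => tE t = tW t').toList).map (tAt enc))

/-- `U(t) = ⋁{𝚝' : t' ∈ W, t_N = t'_S}`: the permissible upwards neighbours. -/
noncomputable def Ut (W : Finset Tile) (t : Tile) : Fml :=
  bigOr (emptyOr enc) (((W.filter fun t' => tN t = tS t').toList).map (tAt enc))

/-- The grid formula `G_{i,j}`. -/
noncomputable def Gf (W : Finset Tile) (i j : Bool) : Fml :=
  .and (mAt enc i j)
    (bigOr (emptyOr enc)
      ((W.toList).map fun t =>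
        .and (tAt enc t)
          (.imp (yAt enc)
            (.or (mAt enc i j) (.and (mAt enc i (!j)) (Ut enc W t))))))

/-- The formula `x'`. -/
noncomputable def xPrime (W : Finset Tile) : Fml :=
  .and (xAt enc) <| .and (pAt enc) <| .and (.imp (pAt enc) (pAt enc)) <|
    .and (bigAnd (emptyAnd enc)
        ((listProd (W.toList) boolPairs).map fun q =>
          .imp (.and (mAt enc q.2.1 q.2.2) (tAt enc q.1))
            (.or (mAt enc q.2.1 q.2.2) (.and (mAt enc (!q.2.1) q.2.2) (Rt enc W q.1))))) <|
      .and (bigAnd (emptyAnd enc)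
          ((listProd boolPairs boolPairs).filterMap fun q =>
            if q.1 ≠ q.2 then
              some (.imp (.and (mAt enc q.1.1 q.1.2) (mAt enc q.2.1 q.2.2))
                (.and (mAt enc false false) (mAt enc false true)))
            else none))
        (bigAnd (emptyAnd enc)
          ((listProd (W.toList) (W.toList)).filterMap fun q =>
            if q.1 ≠ q.2 then
              some (.imp (.and (tAt enc q.1) (tAt enc q.2))
                (.and (mAt enc false false) (mAt enc false true)))
            else none))

/-- The formula `y' = 𝚢 ∧ 𝚙⊤ ∧ (𝚙⊤ → 𝚙⊤)`. -/
def yPrime : Fml := .and (yAt enc) (.and (pAt enc) (.imp (pAt enc) (pAt enc)))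

/-- The notational complement `m^c_{i,j} = 𝚖_{i,1−j} ∨ 𝚖_{1−i,j} ∨ 𝚖_{1−i,1−j}`. -/
def mc (i j : Bool) : Fml :=
  .or (mAt enc i (!j)) (.or (mAt enc (!i) j) (mAt enc (!i) (!j)))

/-- The formula `α = ⋀_{i,j} (m^c_{i,j} → m^c_{i,j})`. -/
def alphaF : Fml :=
  bigAnd (emptyAnd enc) (boolPairs.map fun q => .imp (mc enc q.1 q.2) (mc enc q.1 q.2))

/-- The formula `β₁ = ⋀_{i} ((y' → m^c_{i,i}) → m^c_{i,1−i})`. -/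
def beta1F : Fml :=
  .and (.imp (.imp (yPrime enc) (mc enc false false)) (mc enc false true))
    (.imp (.imp (yPrime enc) (mc enc true true)) (mc enc true false))

/-- The formula `β₂ = ⋀_{i} ((x' → m^c_{1−i,i}) → m^c_{i,i})`. -/
noncomputable def beta2F (W : Finset Tile) : Fml :=
  .and (.imp (.imp (xPrime enc W) (mc enc true false)) (mc enc false false))
    (.imp (.imp (xPrime enc W) (mc enc false true)) (mc enc true true))

/-- The formula `γ = 𝚙⊤ → ⋁_{i,j} G_{i,j}`. -/
noncomputable def gammaF (W : Finset Tile) : Fml :=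
  .imp (pAt enc) (bigOr (emptyOr enc) (boolPairs.map fun q => Gf enc W q.1 q.2))

/-- The tiling formula `ψ_W = (α ∧ β₁ ∧ β₂ ∧ γ ∧ G_{0,0}) → (x' → m^c_{1,0})`. -/
noncomputable def psiW (W : Finset Tile) : Fml :=
  .imp
    (.and (alphaF enc) (.and (beta1F enc) (.and (beta2F enc W)
      (.and (gammaF enc W) (Gf enc W false false)))))
    (.imp (xPrime enc W) (mc enc true false))


section Core

variable {K : Type*}

/-- Two distinct colours force the surrogate falsum. -/
def OneCol (M : Bool → Bool → K → Prop) (z : K) : Prop :=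
  ∀ i j i' j', M i j z → M i' j' z → i = i' ∧ j = j'

/-- `z` can have no colour but `(i,j)`. -/
def OnlyCol (M : Bool → Bool → K → Prop) (i j : Bool) (z : K) : Prop :=
  ∀ i' j', M i' j' z → i' = i ∧ j' = j

/-- The semantic content of the grid formula, apart from degenerate cases. -/
def Gsem (op : K → K → Set K) (W : Finset Tile) (M : Bool → Bool → K → Prop)
    (T : Tile → K → Prop) (B : K → Prop) (i j : Bool) (t : Tile) (z : K) : Prop :=
  M i j z ∧ t ∈ W ∧ T t z ∧ ∀ y v, B y → v ∈ op z y →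
    M i j v ∨ (M i (!j) v ∧ ((M false false v ∧ M false true v) ∨
      ∃ t' ∈ W, tN t = tS t' ∧ T t' v))

/-- Pushing `g` through a left-associated chain. -/
theorem chain_shift (op : K → K → Set K)
    (hH : ∀ x y z, z ∈ op x y → ∃ w ∈ op x y, z ∈ op x w)
    (hP : ∀ x y z c d, c ∈ op x y → d ∈ op c z → ∃ w ∈ op y z, d ∈ op x w)
    (g : K) (c a : ℕ → K) (h0 : c 0 = g) (N : ℕ)
    (hc : ∀ n < N, c (n+1) ∈ op (c n) (a n)) :
    ∃ c' : ℕ → K, c' 0 = g ∧ ∀ n < N, c' (n+1) ∈ op (c' n) (a n) ∧ c (n+1) ∈ op g (c' (n+1)) := by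
  induction N with
  | zero => exact ⟨fun _ => g, rfl, by intro n hn; omega⟩
  | succ N ih =>
    obtain ⟨c', h0', hc'⟩ := ih (fun n hn => hc n (by omega))
    have key : ∃ w ∈ op (c' N) (a N), c (N+1) ∈ op g w := by
      have h1 := hc N (by omega)
      rcases Nat.eq_zero_or_pos N with rfl | hN
      · rw [h0] at h1
        rw [h0']
        exact hH _ _ _ h1
      · obtain ⟨n, rfl⟩ : ∃ n, N = n + 1 := ⟨N - 1, by omega⟩
        exact hP _ _ _ _ _ (hc' n (by omega)).2 h1
    obtain ⟨w, hw, hw'⟩ := key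
    refine ⟨fun n => if n = N + 1 then w else c' n, by simp [h0'], ?_⟩
    intro n hn
    by_cases hnN : n = N
    · subst hnN
      simp [hw, hw']
    · have := hc' n (by omega)
      have e1 : n ≠ N + 1 := by omega
      simp [e1, hnN, this]

/-- The colour of the `n`th point of the staircase. -/
def stC (n : ℕ) : Bool × Bool := (((n+1)/2).bodd, (n/2).bodd)

theorem chain_exists (op : K → K → Set K)
    (hH : ∀ x y z, z ∈ op x y → ∃ w ∈ op x y, z ∈ op x w)
    (hP : ∀ x y z c d, c ∈ op x y → d ∈ op c z → ∃ w ∈ op y z, d ∈ op x w)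
    (g : K) (M : Bool → Bool → K → Prop) (A B : K → Prop)
    (hα : ∀ i j w z, z ∈ op g w → OnlyCol M i j z → OnlyCol M i j w)
    (hβ1 : ∀ i w z, z ∈ op g w → OnlyCol M i (!i) z →
      ∃ a v, B a ∧ v ∈ op w a ∧ OnlyCol M i i v)
    (hβ2 : ∀ i w z, z ∈ op g w → OnlyCol M i i z →
      ∃ a v, A a ∧ v ∈ op w a ∧ OnlyCol M (!i) i v)
    (h1 : ∃ a v, A a ∧ v ∈ op g a ∧ OnlyCol M true false v) (N : ℕ) :
    ∃ c a : ℕ → K, c 0 = g ∧ ∀ n < N, c (n+1) ∈ op (c n) (a n) ∧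
      OnlyCol M (stC (n+1)).1 (stC (n+1)).2 (c (n+1)) ∧
      (n.bodd = false → A (a n)) ∧ (n.bodd = true → B (a n)) := by
  induction N with
  | zero => exact ⟨fun _ => g, fun _ => g, rfl, by intro n hn; omega⟩
  | succ N ih =>
    obtain ⟨c, a, h0, hc⟩ := ih
    obtain ⟨c', h0', hc'⟩ := chain_shift op hH hP g c a h0 N (fun n hn => (hc n hn).1)
    have key : ∃ b v, v ∈ op (c' N) b ∧ OnlyCol M (stC (N+1)).1 (stC (N+1)).2 v ∧
      (N.bodd = false → A b) ∧ (N.bodd = true → B b) := by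
      rcases Nat.eq_zero_or_pos N with rfl | hN
      · obtain ⟨b, v, hb, hv, hv'⟩ := h1
        rw [h0']
        exact ⟨b, v, hv, by simpa [stC] using hv', by simp [hb], by simp⟩
      · obtain ⟨n, rfl⟩ : ∃ n, N = n + 1 := ⟨N - 1, by omega⟩
        have hz := (hc' n (by omega)).2
        have hcol := (hc n (by omega)).2.1
        rcases Nat.even_or_odd' n with ⟨k, rfl | rfl⟩
        · have e1 : (2 * k + 1 + 1) / 2 = k + 1 := by omega
          have e2 : (2 * k + 1) / 2 = k := by omega
          have e3 : (2 * k + 1 + 1 + 1) / 2 = k + 1 := by omega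
          simp only [stC, e1, e2, e3] at hcol ⊢
          obtain ⟨b, v, hb, hv, hv'⟩ := hβ1 (k+1).bodd _ _ hz (by simpa using hcol)
          exact ⟨b, v, hv, hv', by simp, by simp [hb]⟩
        · have e1 : (2 * k + 1 + 1) / 2 = k + 1 := by omega
          have e2 : (2 * k + 1 + 1 + 1 + 1) / 2 = k + 2 := by omega
          have e3 : (2 * k + 1 + 1 + 1) / 2 = k + 1 := by omega
          simp only [stC, e1, e2, e3] at hcol ⊢
          obtain ⟨b, v, hb, hv, hv'⟩ := hβ2 (k+1).bodd _ _ hz hcol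
          exact ⟨b, v, hv, by simpa using hv', by simp [hb], by simp⟩
    obtain ⟨b, v, hv, hvc, hbA, hbB⟩ := key
    refine ⟨fun n => if n = N + 1 then v else c' n, fun n => if n = N then b else a n,
      by simp [h0'], ?_⟩
    intro n hn
    by_cases hnN : n = N
    · subst hnN
      simp only [if_true]
      refine ⟨by simpa using hv, hvc, hbA, hbB⟩
    · have hh := hc' n (by omega)
      have hh2 := hc n (by omega)
      have e1 : n ≠ N + 1 := by omega
      have e2 : n + 1 ≠ N + 1 := by omega
      simp only [e1, e2, hnN, if_false]
      exact ⟨hh.1, hα _ _ _ _ hh.2 hh2.2.1, hh2.2.2⟩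

/-- Lifting one row of the grid. -/
theorem row_lift (op : K → K → Set K)
    (hP : ∀ x y z c d, c ∈ op x y → d ∈ op c z → ∃ w ∈ op y z, d ∈ op x w)
    (X : ℕ → K) (r : ℕ → K) (y : K) (n : ℕ) (q : K)
    (hr : ∀ m < n, r (m+1) ∈ op (X m) (r m)) (hq : q ∈ op (r n) y) :
    ∃ r' : ℕ → K, r' n = q ∧ (∀ m ≤ n, r' m ∈ op (r m) y) ∧
      ∀ m < n, r' (m+1) ∈ op (X m) (r' m) := by
  induction n generalizing q with
  | zero =>
    refine ⟨fun _ => q, rfl, ?_, by intro m hm; omega⟩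
    intro m hm
    obtain rfl : m = 0 := by omega
    exact hq
  | succ n ih =>
    obtain ⟨w, hw, hqw⟩ := hP _ _ _ _ _ (hr n (by omega)) hq
    obtain ⟨r', h1, h2, h3⟩ := ih w (fun m hm => hr m (by omega)) hw
    refine ⟨fun m => if m = n + 1 then q else r' m, by simp, ?_, ?_⟩
    · intro m hm
      by_cases e : m = n + 1
      · subst e; simpa using hq
      · simp only [e, if_false]; exact h2 m (by omega)
    · intro m hm
      have e : m ≠ n + 1 := by omega
      by_cases e' : m = n
      · subst e'; simpa [h1] using hqw
      · simp only [e, if_false]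
        have e2 : m + 1 ≠ n + 1 := by omega
        simp only [e2, if_false]
        exact h3 m (by omega)

theorem grid_exists (op : K → K → Set K)
    (hP : ∀ x y z c d, c ∈ op x y → d ∈ op c z → ∃ w ∈ op y z, d ∈ op x w)
    (hS : ∀ x y z c d, c ∈ op x y → d ∈ op c z → ∃ w ∈ op x z, d ∈ op y w)
    (D E X Y : ℕ → K) (N : ℕ)
    (hE : ∀ n < N, E n ∈ op (D n) (X n)) (hD : ∀ n < N, D (n+1) ∈ op (E n) (Y n)) :
    ∃ P : ℕ → ℕ → K, (∀ n ≤ N, P n n = D n) ∧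
      (∀ m n, m < n → n ≤ N → P (m+1) n ∈ op (X m) (P m n)) ∧
      (∀ m n, m ≤ n → n < N → P m (n+1) ∈ op (P m n) (Y n)) := by
  induction N with
  | zero =>
    exact ⟨fun _ _ => D 0, by intro n hn; obtain rfl : n = 0 := by omega
                              rfl, by intros; omega, by intros; omega⟩
  | succ N ih =>
    obtain ⟨P, h1, h2, h3⟩ := ih (fun n hn => hE n (by omega)) (fun n hn => hD n (by omega))
    obtain ⟨q, hq, hDq⟩ := hS _ _ _ _ _ (hE N (by omega)) (hD N (by omega))
    rw [← h1 N le_rfl] at hq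
    obtain ⟨r', e1, e2, e3⟩ := row_lift op hP X (fun m => P m N) (Y N) N q
      (fun m hm => h2 m N hm le_rfl) hq
    refine ⟨fun m n => if n = N + 1 then (if m = N + 1 then D (N+1) else r' m) else P m n,
      ?_, ?_, ?_⟩
    · intro n hn
      by_cases e : n = N + 1
      · simp [e]
      · simp only [e, if_false]; exact h1 n (by omega)
    · intro m n hm hn
      by_cases e : n = N + 1
      · simp only [e, if_true]
        have em : m ≠ N + 1 := by omega
        simp only [em, if_false]
        by_cases em' : m = N
        · subst em'; simpa [e1] using hDq
        · have : m + 1 ≠ N + 1 := by omega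
          simp only [this, if_false]
          exact e3 m (by omega)
      · simp only [e, if_false]; exact h2 m n hm (by omega)
    · intro m n hm hn
      have en : n ≠ N + 1 := by omega
      simp only [en, if_false]
      by_cases e : n = N
      · subst e
        have em : m ≠ n + 1 := by omega
        simp only [if_true, em, if_false]
        exact e2 m hm
      · have : n + 1 ≠ N + 1 := by omega
        simp only [this, if_false]
        exact h3 m n hm (by omega)

theorem core (op : K → K → Set K)
    (hH : ∀ x y z, z ∈ op x y → ∃ w ∈ op x y, z ∈ op x w)
    (hP : ∀ x y z c d, c ∈ op x y → d ∈ op c z → ∃ w ∈ op y z, d ∈ op x w)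
    (hS : ∀ x y z c d, c ∈ op x y → d ∈ op c z → ∃ w ∈ op x z, d ∈ op y w)
    (W : Finset Tile) (g : K) (M : Bool → Bool → K → Prop) (T : Tile → K → Prop)
    (A B Pt : K → Prop)
    (hα : ∀ i j w z, z ∈ op g w → OnlyCol M i j z → OnlyCol M i j w)
    (hβ1 : ∀ i w z, z ∈ op g w → OnlyCol M i (!i) z →
      ∃ a v, B a ∧ v ∈ op w a ∧ OnlyCol M i i v)
    (hβ2 : ∀ i w z, z ∈ op g w → OnlyCol M i i z →
      ∃ a v, A a ∧ v ∈ op w a ∧ OnlyCol M (!i) i v)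
    (hγ : ∀ u z, Pt u → z ∈ op g u → (M false false z ∧ M false true z) ∨
      ∃ i j t, Gsem op W M T B i j t z)
    (hg0 : ∀ y v, B y → v ∈ op g y → M false false v ∨ M false true v)
    (hA : ∀ a, A a → ∀ i j t z v, t ∈ W → M i j z → T t z → v ∈ op a z →
      M i j v ∨ (M (!i) j v ∧ ((M false false v ∧ M false true v) ∨
      ∃ t' ∈ W, tE t = tW t' ∧ T t' v)))
    (hA1 : ∀ a, A a → ∀ z v, ¬ OneCol M z → v ∈ op a z → M false false v ∧ M false true v)
    (hA2 : ∀ a, A a → ∀ t t' z v, t ∈ W → t' ∈ W → t ≠ t' → T t z → T t' z → v ∈ op a z →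
      M false false v ∧ M false true v)
    (hAP : ∀ a, A a ∨ B a → Pt a ∧ ∀ u v, Pt u → v ∈ op a u → Pt v)
    (h1 : ∃ a v, A a ∧ v ∈ op g a ∧ OnlyCol M true false v) (k : ℕ) :
    Tiles W (Octant k) := by
  obtain ⟨c, a, hc0, hc⟩ := chain_exists op hH hP g M A B hα hβ1 hβ2 h1 (2 * (k + 2))
  obtain ⟨P, hPd, hPx, hPy⟩ := grid_exists op hP hS (fun n => c (2*n)) (fun n => c (2*n+1))
    (fun n => a (2*n)) (fun n => a (2*n+1)) (k+2)
    (fun n hn => (hc (2*n) (by omega)).1)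
    (fun n hn => (hc (2*n+1) (by omega)).1)
  have hXA : ∀ n < k + 2, A (a (2*n)) := fun n hn => (hc (2*n) (by omega)).2.2.1 (by simp)
  have hYB : ∀ n < k + 2, B (a (2*n+1)) := fun n hn => (hc (2*n+1) (by omega)).2.2.2 (by simp)
  have hdiag : ∀ n, 0 < n → n ≤ k + 2 → OnlyCol M n.bodd n.bodd (P n n) := by
    intro n hn hn'
    obtain ⟨m, rfl⟩ : ∃ m, n = m + 1 := ⟨n - 1, by omega⟩
    rw [hPd _ hn']
    have := (hc (2*m+1) (by omega)).2.1
    have e1 : (2 * m + 1 + 1) / 2 = m + 1 := by omega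
    have e2 : (2 * m + 1 + 1 + 1) / 2 = m + 1 := by omega
    simp only [stC, e1, e2] at this
    exact this
  -- membership in `g · p⊤`
  let H : K → Prop := fun z => ∃ u, z ∈ op g u ∧ Pt u ∧ ∀ v w, Pt v → w ∈ op u v → Pt w
  have hHs : ∀ z b z', H z → (A b ∨ B b) → z' ∈ op z b → H z' := by
    rintro z b z' ⟨u, hu, hu1, hu2⟩ hb hz'
    obtain ⟨w, hw, hw'⟩ := hP _ _ _ _ _ hu hz'
    refine ⟨w, hw', hu2 _ _ (hAP b hb).1 hw, ?_⟩
    intro p q hp hq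
    obtain ⟨s, hs, hs'⟩ := hP _ _ _ _ _ hw hq
    exact hu2 _ _ ((hAP b hb).2 _ _ hp hs) hs'
  have hHg : ∀ b z', (A b ∨ B b) → z' ∈ op g b → H z' := by
    intro b z' hb hz'
    exact ⟨b, hz', (hAP b hb).1, (hAP b hb).2⟩
  have hab : ∀ n < 2 * (k+2), A (a n) ∨ B (a n) := by
    intro n hn
    cases h : n.bodd
    · exact Or.inl ((hc n hn).2.2.1 h)
    · exact Or.inr ((hc n hn).2.2.2 h)
  have hHc : ∀ n, n < 2 * (k+2) → H (c (n+1)) := by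
    intro n
    induction n with
    | zero =>
      intro hn
      have := (hc 0 hn).1
      rw [hc0] at this
      exact hHg _ _ (hab 0 hn) this
    | succ n ih =>
      intro hn
      exact hHs _ _ _ (ih (by omega)) (hab _ hn) (hc _ hn).1
  have hHP : ∀ n, 0 < n → n ≤ k + 2 → ∀ m ≤ n, H (P m n) := by
    intro n
    induction n with
    | zero => intro h; omega
    | succ n ih =>
      intro _ hn m hm
      by_cases e : m = n + 1
      · subst e
        rw [hPd _ hn]
        exact hHc (2*n+1) (by omega)
      · have h3 := hPy m n (by omega) (by omega)
        rcases Nat.eq_zero_or_pos n with rfl | hn0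
        · obtain rfl : m = 0 := by omega
          rw [hPd 0 (by omega)] at h3
          simp only [Nat.mul_zero, hc0] at h3
          exact hHg _ _ (hab _ (by omega)) h3
        · exact hHs _ _ _ (ih hn0 (by omega) m (by omega)) (hab _ (by omega)) h3
  have ndead : ∀ z, OneCol M z → ¬ (M false false z ∧ M false true z) := by
    intro z hz h
    exact absurd (hz _ _ _ _ h.1 h.2).2 (by decide)
  have hone : ∀ n, 0 < n → n ≤ k + 2 → ∀ d m, m + d = n → OneCol M (P m n) := by
    intro n hn hn' d
    induction d with
    | zero =>
      intro m hm
      obtain rfl : m = n := by omega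
      intro i j i' j' h h'
      obtain ⟨e1, e2⟩ := hdiag m hn hn' i j h
      obtain ⟨e3, e4⟩ := hdiag m hn hn' i' j' h'
      exact ⟨e1.trans e3.symm, e2.trans e4.symm⟩
    | succ d ih =>
      intro m hm
      by_contra hcon
      exact ndead _ (ih (m+1) (by omega))
        (hA1 _ (hXA m (by omega)) _ _ hcon (hPx m n (by omega) hn'))
  have hone' : ∀ n, 0 < n → n ≤ k + 2 → ∀ m ≤ n, OneCol M (P m n) := fun n hn hn' m hm =>
    hone n hn hn' (n - m) m (by omega)
  have hG : ∀ n, 0 < n → n ≤ k + 2 → ∀ m ≤ n, ∃ i j t, Gsem op W M T B i j t (P m n) := by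
    intro n hn hn' m hm
    obtain ⟨u, hu, hu1, -⟩ := hHP n hn hn' m hm
    rcases hγ u _ hu1 hu with h | h
    · exact absurd h (ndead _ (hone' n hn hn' m hm))
    · exact h
  have hcol : ∀ m, ∀ n, 0 < n → n ≤ k + 2 → m ≤ n → ∃ j, M m.bodd j (P m n) := by
    intro m n
    induction n with
    | zero => intro h; omega
    | succ n ih =>
      intro _ hn hm
      by_cases e : m = n + 1
      · subst e
        obtain ⟨i, j, t, hM, -⟩ := hG (n+1) (by omega) hn (n+1) le_rfl
        have := (hdiag (n+1) (by omega) hn i j hM).1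
        exact ⟨j, this ▸ hM⟩
      · have h3 := hPy m n (by omega) (by omega)
        rcases Nat.eq_zero_or_pos n with rfl | hn0
        · obtain rfl : m = 0 := by omega
          rw [hPd 0 (by omega)] at h3
          simp only [Nat.mul_zero, hc0] at h3
          rcases hg0 _ _ (hYB 0 (by omega)) h3 with h | h
          · exact ⟨_, h⟩
          · exact ⟨_, h⟩
        · obtain ⟨j0, hj0⟩ := ih hn0 (by omega) (by omega)
          obtain ⟨i, j, t, hM, -, -, hy⟩ := hG n hn0 (by omega) m (by omega)
          have ei := (hone' n hn0 (by omega) m (by omega) _ _ _ _ hM hj0).1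
          subst ei
          rcases hy _ _ (hYB n (by omega)) h3 with h | h
          · exact ⟨_, h⟩
          · exact ⟨_, h.1⟩
  have hrow : ∀ n, 0 < n → n ≤ k + 2 → ∀ d m, m + d = n → ∃ i, M i n.bodd (P m n) := by
    intro n hn hn' d
    induction d with
    | zero =>
      intro m hm
      obtain rfl : m = n := by omega
      obtain ⟨i, j, t, hM, -⟩ := hG m hn hn' m le_rfl
      have := (hdiag m hn hn' i j hM).2
      exact ⟨i, this ▸ hM⟩
    | succ d ih =>
      intro m hm
      obtain ⟨i0, hi0⟩ := ih (m+1) (by omega)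
      obtain ⟨i, j, t, hM, ht, hT, -⟩ := hG n hn hn' m (by omega)
      have h1 := hone' n hn hn' (m+1) (by omega)
      have : j = n.bodd := by
        rcases hA _ (hXA m (by omega)) _ _ _ _ _ ht hM hT (hPx m n (by omega) hn') with h | h
        · exact (h1 _ _ _ _ h hi0).2
        · exact (h1 _ _ _ _ h.1 hi0).2
      exact ⟨i, this ▸ hM⟩
  have hGG : ∀ n, 0 < n → n ≤ k + 2 → ∀ m ≤ n,
      ∃ t, Gsem op W M T B m.bodd n.bodd t (P m n) := by
    intro n hn hn' m hm
    obtain ⟨i, j, t, h⟩ := hG n hn hn' m hm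
    obtain ⟨j0, hj0⟩ := hcol m n hn hn' hm
    obtain ⟨i0, hi0⟩ := hrow n hn hn' (n - m) m (by omega)
    have h1 := hone' n hn hn' m hm
    have e1 := (h1 _ _ _ _ h.1 hj0).1
    have e2 := (h1 _ _ _ _ h.1 hi0).2
    subst e1 e2
    exact ⟨t, h⟩
  have huniq : ∀ n, 0 < n → n ≤ k + 2 → ∀ m < n, ∀ t t', t ∈ W → t' ∈ W → T t (P m n) →
      T t' (P m n) → t = t' := by
    intro n hn hn' m hm t t' ht ht' hT hT'
    by_contra hne
    exact ndead _ (hone' n hn hn' (m+1) (by omega))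
      (hA2 _ (hXA m (by omega)) t t' _ _ ht ht' hne hT hT' (hPx m n hm hn'))
  have hτ : ∃ τ : ℕ → ℕ → Tile, ∀ m n, 0 < n → n ≤ k + 2 → m ≤ n →
      Gsem op W M T B m.bodd n.bodd (τ m n) (P m n) := by
    have : ∀ m n, ∃ t, 0 < n → n ≤ k + 2 → m ≤ n →
        Gsem op W M T B m.bodd n.bodd t (P m n) := by
      intro m n
      by_cases h : 0 < n ∧ n ≤ k + 2 ∧ m ≤ n
      · obtain ⟨t, ht⟩ := hGG n h.1 h.2.1 m h.2.2
        exact ⟨t, fun _ _ _ => ht⟩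
      · exact ⟨(0,0,0,0), fun h1 h2 h3 => absurd ⟨h1, h2, h3⟩ h⟩
    choose τ hτ using this
    exact ⟨τ, hτ⟩
  obtain ⟨τ, hτ⟩ := hτ
  refine ⟨fun p => τ p.1.toNat (p.2.toNat + 1), ?_, ?_, ?_⟩
  · rintro ⟨m, n⟩ ⟨h1, h2, h3⟩
    simp only at h1 h2 h3 ⊢
    exact (hτ _ _ (by omega) (by omega) (by omega)).2.1
  · rintro m n ⟨h1, h2, h3⟩ ⟨h4, h5, h6⟩
    simp only at *
    lift m to ℕ using h1
    lift n to ℕ using (by omega)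
    have e : ((m : ℤ) + 1).toNat = m + 1 := by omega
    simp only [e, Int.toNat_natCast]
    have hs := hτ m (n+1) (by omega) (by omega) (by omega)
    have ht := hτ (m+1) (n+1) (by omega) (by omega) (by omega)
    have ho := hone' (n+1) (by omega) (by omega) (m+1) (by omega)
    rcases hA _ (hXA m (by omega)) _ _ _ _ _ hs.2.1 hs.1 hs.2.2.1
      (hPx m (n+1) (by omega) (by omega)) with h | ⟨-, h | ⟨t', ht', he, hT'⟩⟩
    · have := (ho _ _ _ _ h ht.1).1
      simp at this
    · exact absurd h (ndead _ ho)
    · rw [he, huniq (n+1) (by omega) (by omega) (m+1) (by omega) _ _ ht' ht.2.1 hT' ht.2.2.1]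
  · rintro m n ⟨h1, h2, h3⟩ ⟨h4, h5, h6⟩
    simp only at *
    lift m to ℕ using h1
    lift n to ℕ using (by omega)
    have e : ((n : ℤ) + 1).toNat = n + 1 := by omega
    simp only [e, Int.toNat_natCast]
    have hs := hτ m (n+1) (by omega) (by omega) (by omega)
    have ht := hτ m (n+1+1) (by omega) (by omega) (by omega)
    have ho := hone' (n+1+1) (by omega) (by omega) m (by omega)
    rcases hs.2.2.2 _ _ (hYB (n+1) (by omega))
      (hPy m (n+1) (by omega) (by omega)) with h | ⟨-, h | ⟨t', ht', he, hT'⟩⟩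
    · have := (ho _ _ _ _ h ht.1).2
      simp at this
    · exact absurd h (ndead _ ho)
    · rw [he, huniq (n+1+1) (by omega) (by omega) m (by omega) _ _ ht' ht.2.1 hT' ht.2.2.1]

end Core

section SatLemmas

variable {K : Type*} {op : K → K → Set K} {V : ℕ → Set K}

theorem sat_foldl_or (z : K) (l : List Fml) (f : Fml) (h : Sat op V z (l.foldl .or f)) :
    ∃ f' ∈ f :: l, Sat op V z f' := by
  induction l generalizing f with
  | nil => exact ⟨f, by simp, h⟩
  | cons e l ih =>
    obtain ⟨f', hf', hs⟩ := ih _ h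
    rcases List.mem_cons.1 hf' with rfl | hm
    · rcases hs with hs | hs
      · exact ⟨f, by simp, hs⟩
      · exact ⟨e, by simp, hs⟩
    · exact ⟨f', by simp [hm], hs⟩

theorem sat_bigOr {z : K} {d : Fml} {l : List Fml} (h : Sat op V z (bigOr d l)) :
    Sat op V z d ∨ ∃ f ∈ l, Sat op V z f := by
  cases l with
  | nil => exact Or.inl h
  | cons f l => exact Or.inr (sat_foldl_or z l f h)

theorem sat_bigOr_ne {z : K} {d : Fml} {l : List Fml} (hl : l ≠ [])
    (h : Sat op V z (bigOr d l)) : ∃ f ∈ l, Sat op V z f := by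
  cases l with
  | nil => exact absurd rfl hl
  | cons f l => exact sat_foldl_or z l f h

theorem sat_foldl_and (z : K) (l : List Fml) (f : Fml) (h : Sat op V z (l.foldl .and f)) :
    ∀ f' ∈ f :: l, Sat op V z f' := by
  induction l generalizing f with
  | nil => intro f' hf'; simp at hf'; subst hf'; exact h
  | cons e l ih =>
    have := ih _ h
    have h0 := this _ (List.mem_cons_self)
    intro f' hf'
    rcases List.mem_cons.1 hf' with rfl | hm
    · exact h0.1
    · rcases List.mem_cons.1 hm with rfl | hm
      · exact h0.2
      · exact this _ (List.mem_cons_of_mem _ hm)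

theorem sat_bigAnd {z : K} {d : Fml} {l : List Fml} (h : Sat op V z (bigAnd d l)) :
    ∀ f ∈ l, Sat op V z f := by
  cases l with
  | nil => intro f hf; simp at hf
  | cons f l => exact sat_foldl_and z l f h

theorem mem_listProd {α β : Type*} (l₁ : List α) (l₂ : List β) (a : α) (b : β)
    (ha : a ∈ l₁) (hb : b ∈ l₂) : (a, b) ∈ listProd l₁ l₂ := by
  induction l₁ with
  | nil => simp at ha
  | cons c l ih =>
    simp only [listProd, List.foldr_cons, List.mem_append, List.mem_map]
    rcases List.mem_cons.1 ha with rfl | h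
    · exact Or.inl ⟨b, hb, rfl⟩
    · exact Or.inr (ih h)

theorem mem_boolPairs (q : Bool × Bool) : q ∈ boolPairs := by
  rcases q with ⟨_ | _, _ | _⟩ <;> simp [boolPairs]

theorem onlyCol_iff (enc : Letter → ℕ) (i j : Bool) (z : K) :
    OnlyCol (fun i j z => z ∈ V (enc (.m i j))) i j z ↔ ¬ Sat op V z (mc enc i j) := by
  simp only [mc, Sat, mAt, OnlyCol, Bool.forall_bool]
  cases i <;> cases j <;> simp <;> tauto

end SatLemmas

/-- the first tiling lemma, semantic form: if a structure `(K, ·)`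
satisfying (h), (p) and (s) has, for some valuation, a point `g` satisfying
`α ∧ β₁ ∧ β₂ ∧ γ ∧ G_{0,0}` but not `x' → m^c_{1,0}`, then `W` tiles every
octant `𝕆(k)`. -/
theorem refutation_gives_octant_tilings {K : Type*} (op : K → K → Set K)
    (hH : ∀ x y : K, op x y ⊆ setL op x (op x y))
    (hP : ∀ x y z : K, setR op (op x y) z ⊆ setL op x (op y z))
    (hS : ∀ x y z : K, setR op (op x y) z ⊆ setL op y (op x z))
    (W : Finset Tile) (enc : Letter → ℕ) (henc : Function.Injective enc)
    (V : ℕ → Set K) (g : K)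
    (hsat : Sat op V g (.and (alphaF enc) (.and (beta1F enc) (.and (beta2F enc W)
      (.and (gammaF enc W) (Gf enc W false false))))))
    (href : ¬ Sat op V g (.imp (xPrime enc W) (mc enc true false))) :
    ∀ k : ℕ, Tiles W (Octant k) := by
  intro k
  obtain ⟨hα, hβ1, hβ2, hγ, hG⟩ := hsat
  have hα' := sat_bigAnd hα
  have hGsem : ∀ z i j, Sat op V z (Gf enc W i j) →
      (z ∈ V (enc (.m false false)) ∧ z ∈ V (enc (.m false true))) ∨
      ∃ t, Gsem op W (fun i j z => z ∈ V (enc (.m i j))) (fun t z => z ∈ V (enc (.tile t)))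
        (fun a => Sat op V a (yPrime enc)) i j t z := by
    rintro z i j ⟨hm, hor⟩
    rcases sat_bigOr hor with h | ⟨f, hf, hs⟩
    · exact Or.inl h
    · right
      obtain ⟨t, ht, rfl⟩ := List.mem_map.1 hf
      refine ⟨t, hm, by simpa using ht, hs.1, ?_⟩
      intro y v hy hv
      rcases hs.2 y v hy.1 hv with h | ⟨h, hU⟩
      · exact Or.inl h
      · refine Or.inr ⟨h, ?_⟩
        rcases sat_bigOr hU with h' | ⟨f, hf, hs'⟩
        · exact Or.inl h'
        · obtain ⟨t', ht', rfl⟩ := List.mem_map.1 hf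
          simp only [Finset.mem_toList, Finset.mem_filter] at ht'
          exact Or.inr ⟨t', ht'.1, ht'.2, hs'⟩
  have hγ' : ∀ u z, u ∈ V (enc .pTop) → z ∈ op g u →
      (z ∈ V (enc (.m false false)) ∧ z ∈ V (enc (.m false true))) ∨
      ∃ i j t, Gsem op W (fun i j z => z ∈ V (enc (.m i j)))
        (fun t z => z ∈ V (enc (.tile t))) (fun a => Sat op V a (yPrime enc)) i j t z := by
    intro u z hu hz
    rcases sat_bigOr (hγ u z hu hz) with h | ⟨f, hf, hs⟩
    · exact Or.inl h
    · obtain ⟨⟨i, j⟩, -, rfl⟩ := List.mem_map.1 hf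
      rcases hGsem z i j hs with h | ⟨t, h⟩
      · exact Or.inl h
      · exact Or.inr ⟨i, j, t, h⟩
  have h1 : ∃ a v, Sat op V a (xPrime enc W) ∧ v ∈ op g a ∧
      OnlyCol (fun i j z => z ∈ V (enc (.m i j))) true false v := by
    simp only [onlyCol_iff (op := op)]
    by_contra hcon
    push Not at hcon
    exact href (fun a v ha hv => hcon a v ha hv)
  have hne : W.toList ≠ [] := by
    obtain ⟨a, v, ha, hv, hcol⟩ := h1
    rcases hγ' a v ha.2.1 hv with h | ⟨i, j, t, h⟩
    · exact absurd (hcol _ _ h.1).1 (by decide)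
    · exact List.ne_nil_of_mem (Finset.mem_toList.2 h.2.1)
  refine core op ?_ ?_ ?_ W g (fun i j z => z ∈ V (enc (.m i j)))
    (fun t z => z ∈ V (enc (.tile t)))
    (fun a => Sat op V a (xPrime enc W)) (fun a => Sat op V a (yPrime enc))
    (fun a => a ∈ V (enc .pTop)) ?_ ?_ ?_ hγ' ?_ ?_ ?_ ?_ ?_ h1 k
  · intro x y z hz
    simpa [setL] using hH x y hz
  · intro x y z c d hc hd
    have : d ∈ setR op (op x y) z := by simp only [setR, Set.mem_iUnion]; exact ⟨c, hc, hd⟩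
    simpa [setL] using hP x y z this
  · intro x y z c d hc hd
    have : d ∈ setR op (op x y) z := by simp only [setR, Set.mem_iUnion]; exact ⟨c, hc, hd⟩
    simpa [setL] using hS x y z this
  · intro i j w z hz hb
    rw [onlyCol_iff (op := op)] at hb ⊢
    intro hw
    exact hb (hα' _ (List.mem_map.2 ⟨(i, j), mem_boolPairs _, rfl⟩) w z hw hz)
  · intro i w z hz hb
    rw [onlyCol_iff (op := op)] at hb
    simp only [onlyCol_iff (op := op)]
    by_contra hcon
    push Not at hcon
    have himp : Sat op V w (.imp (yPrime enc) (mc enc i i)) := fun a v ha hv => hcon a v ha hv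
    cases i
    · exact hb (hβ1.1 w z himp hz)
    · exact hb (hβ1.2 w z himp hz)
  · intro i w z hz hb
    rw [onlyCol_iff (op := op)] at hb
    simp only [onlyCol_iff (op := op)]
    by_contra hcon
    push Not at hcon
    have himp : Sat op V w (.imp (xPrime enc W) (mc enc (!i) i)) :=
      fun a v ha hv => hcon a v ha hv
    cases i
    · exact hb (hβ2.1 w z himp hz)
    · exact hb (hβ2.2 w z himp hz)
  · intro y v hy hv
    obtain ⟨f, hf, hs⟩ := sat_bigOr_ne (by simpa using hne) hG.2
    obtain ⟨t, ht, rfl⟩ := List.mem_map.1 hf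
    rcases hs.2 y v hy.1 hv with h | h
    · exact Or.inl h
    · exact Or.inr h.1
  · rintro a ⟨-, -, -, hR, -, -⟩ i j t z v ht hm hT hv
    have := sat_bigAnd hR _ (List.mem_map.2 ⟨(t, (i, j)),
      mem_listProd _ _ _ _ (Finset.mem_toList.2 ht) (mem_boolPairs _), rfl⟩) z v ⟨hm, hT⟩ hv
    rcases this with h | ⟨h, hU⟩
    · exact Or.inl h
    · refine Or.inr ⟨h, ?_⟩
      rcases sat_bigOr hU with h' | ⟨f, hf, hs'⟩
      · exact Or.inl h'
      · obtain ⟨t', ht', rfl⟩ := List.mem_map.1 hf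
        simp only [Finset.mem_toList, Finset.mem_filter] at ht'
        exact Or.inr ⟨t', ht'.1, ht'.2, hs'⟩
  · rintro a ⟨-, -, -, -, hm, -⟩ z v hz hv
    simp only [OneCol] at hz
    push Not at hz
    obtain ⟨i, j, i', j', h, h', hne⟩ := hz
    have hne' : ((i, j) : Bool × Bool) ≠ (i', j') := by
      intro e
      simp only [Prod.mk.injEq] at e
      exact hne e.1 e.2
    exact sat_bigAnd hm _ (List.mem_filterMap.2 ⟨((i, j), (i', j')),
      mem_listProd _ _ _ _ (mem_boolPairs _) (mem_boolPairs _), if_pos hne'⟩) z v ⟨h, h'⟩ hv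
  · rintro a ⟨-, -, -, -, -, hm⟩ t t' z v ht ht' hne h h' hv
    exact sat_bigAnd hm _ (List.mem_filterMap.2 ⟨(t, t'),
      mem_listProd _ _ _ _ (Finset.mem_toList.2 ht) (Finset.mem_toList.2 ht'), if_pos hne⟩)
      z v ⟨h, h'⟩ hv
  · rintro a (⟨-, h1, h2, -⟩ | ⟨-, h1, h2⟩)
    · exact ⟨h1, h2⟩
    · exact ⟨h1, h2⟩
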